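/- Let d be a positive integer, let a, â ∈ ℝ^d with ‖a‖_{ℓ1} = 1 and ‖â‖_{ℓ1} = 1, let c₀ > 0, and let g : ℝ → ℝ satisfy |g(t₁) − g(t₂)| ≤ c₀|t₁ − t₂| for all t₁, t₂ ∈ [−1,1]. Define ĝ(t) = g(t·⟨a, sign(â)⟩). Then for every t ∈ [−1,1], |g(t) − ĝ(t)| ≤ c₀ ‖a − â‖_{ℓ1}. -/

import Mathlib

theorem Real.abs_sign_le_one (x : ℝ) : |Real.sign x| ≤ 1 := by
  rcases Real.sign_apply_eq x with h | h | h <;> simp [h]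

theorem Real.self_mul_sign (x : ℝ) : x * Real.sign x = |x| := by
  rcases lt_trichotomy x 0 with h | rfl | h
  · simp [Real.sign_of_neg h, abs_of_neg h]
  · simp
  · simp [Real.sign_of_pos h, abs_of_pos h]

theorem abs_sum_mul_sign_le {ι : Type*} [Fintype ι] (v w : ι → ℝ) :
    |∑ i, v i * Real.sign (w i)| ≤ ∑ i, |v i| := by
  refine (Finset.abs_sum_le_sum_abs _ _).trans (Finset.sum_le_sum fun i _ => ?_)
  rw [abs_mul]
  exact mul_le_of_le_one_right (abs_nonneg _) (Real.abs_sign_le_one _)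

theorem stmt_6 (d : ℕ) (hd : 0 < d) (a ah : Fin d → ℝ)
    (ha : ∑ i, |a i| = 1) (hah : ∑ i, |ah i| = 1)
    (c₀ : ℝ) (hc₀ : 0 < c₀) (g : ℝ → ℝ)
    (hlip : ∀ t₁ ∈ Set.Icc (-1 : ℝ) 1, ∀ t₂ ∈ Set.Icc (-1 : ℝ) 1,
      |g t₁ - g t₂| ≤ c₀ * |t₁ - t₂|)
    (gh : ℝ → ℝ) (hgh : ∀ t, gh t = g (t * ∑ i, a i * Real.sign (ah i))) :
    ∀ t ∈ Set.Icc (-1 : ℝ) 1, |g t - gh t| ≤ c₀ * ∑ i, |a i - ah i| := by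
  intro t ht
  have ht' : |t| ≤ 1 := abs_le.2 ht
  have hs := abs_sum_mul_sign_le a ah
  have hdiff := abs_sum_mul_sign_le (fun i => a i - ah i) ah
  simp only [sub_mul, Finset.sum_sub_distrib, Real.self_mul_sign, hah] at hdiff
  rw [ha] at hs
  rw [hgh]
  set s := ∑ i, a i * Real.sign (ah i)
  have hts : t * s ∈ Set.Icc (-1 : ℝ) 1 := by
    refine abs_le.1 ?_
    rw [abs_mul]
    exact mul_le_one₀ ht' (abs_nonneg _) hs
  refine (hlip t ht _ hts).trans (mul_le_mul_of_nonneg_left ?_ hc₀.le)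
  calc |t - t * s| = |t| * |s - 1| := by rw [abs_sub_comm s 1, ← abs_mul]; ring_nf
    _ ≤ |s - 1| := mul_le_of_le_one_left (abs_nonneg _) ht'
    _ ≤ ∑ i, |a i - ah i| := hdiff
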